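/- Let η^ε and η_2^ε = η^ε * η^ε be as above (η symmetric mollifier supported in [-1,1]). Let f : R^{n+2} → R be smooth with integrable derivatives, symmetric. Let U^ε ∈ R^n have i.i.d. components with density η^ε, X_1^ε, X_2^ε have density η^ε, Y^ε have density η_2^ε, all independent. Then |E[f(u+U^ε, x+Y^ε+X_1^ε, x+Y^ε+X_2^ε)] - E[f(u+U^ε, x+X_1^ε, x+X_2^ε)]| ≤ 4ε ∫_0^1 E[|∂_{n+2} f(u+U^ε, x+λY^ε+X_1^ε, x+λY^ε+X_2^ε)|] dλ for every u ∈ R^n and x ∈ R. -/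

import Mathlib

open MeasureTheory

namespace S16

lemma iter_eq {n : ℕ} (φ : (Fin n → ℝ) × ℝ × ℝ × ℝ → ℝ) (hc : Continuous φ)
    (hs : HasCompactSupport φ) :
    ∫ U : Fin n → ℝ, ∫ x₁ : ℝ, ∫ x₂ : ℝ, ∫ y : ℝ, φ (U, x₁, x₂, y) = ∫ t, φ t := by
  have sl : ∀ {X Y : Type} [TopologicalSpace X] [TopologicalSpace Y] [R1Space Y]
      (ψ : X × Y → ℝ) (_ : Continuous ψ) (_ : HasCompactSupport ψ) (a : X),
      Continuous (fun b => ψ (a, b)) ∧ HasCompactSupport (fun b => ψ (a, b)) := by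
    intro X Y _ _ _ ψ h1 h2 a
    refine ⟨by fun_prop, ?_⟩
    refine HasCompactSupport.intro (K := Prod.snd '' (tsupport ψ)) (h2.image continuous_snd) ?_
    intro b hb
    by_contra hne
    exact hb ⟨(a, b), subset_tsupport _ hne, rfl⟩
  rw [Measure.volume_eq_prod, integral_prod _ (hc.integrable_of_hasCompactSupport hs)]
  refine integral_congr_ae (Filter.Eventually.of_forall fun U => ?_)
  obtain ⟨hc1, hs1⟩ := sl φ hc hs U
  dsimp only
  rw [Measure.volume_eq_prod, integral_prod _ (hc1.integrable_of_hasCompactSupport hs1)]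
  refine integral_congr_ae (Filter.Eventually.of_forall fun a => ?_)
  obtain ⟨hc2, hs2⟩ := sl _ hc1 hs1 a
  dsimp only
  rw [Measure.volume_eq_prod, integral_prod _ (hc2.integrable_of_hasCompactSupport hs2)]

lemma sw_mp (n : ℕ) : MeasurePreserving
    (fun t : (Fin n → ℝ) × ℝ × ℝ × ℝ => (t.1, t.2.2.1, t.2.1, t.2.2.2)) volume volume := by
  have h1 : MeasurePreserving (fun t : ℝ × ℝ × ℝ => (t.2.1, t.1, t.2.2)) volume volume := by
    have a := (volume_preserving_prodAssoc (α₁ := ℝ) (β₁ := ℝ) (γ₁ := ℝ))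
    have b : MeasurePreserving (Prod.map (Prod.swap : ℝ × ℝ → ℝ × ℝ) (id : ℝ → ℝ))
        volume volume :=
      (Measure.measurePreserving_swap (μ := (volume : Measure ℝ))
        (ν := (volume : Measure ℝ))).prod (MeasurePreserving.id _)
    exact (a.comp b).comp a.symm
  exact (MeasurePreserving.id (volume : Measure (Fin n → ℝ))).prod h1

lemma main {n : ℕ} (f : (Fin n → ℝ) → ℝ → ℝ → ℝ)
    (hf : ContDiff ℝ (⊤ : ℕ∞) fun p : (Fin n → ℝ) × ℝ × ℝ => f p.1 p.2.1 p.2.2)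
    (hsymm : ∀ u a b, f u a b = f u b a) (u : Fin n → ℝ) (x ε : ℝ)
    (W : (Fin n → ℝ) × ℝ × ℝ × ℝ → ℝ) (hW : Continuous W) (hWs : HasCompactSupport W)
    (hW0 : ∀ t, 0 ≤ W t) (hWsw : ∀ U a b y, W (U, a, b, y) = W (U, b, a, y))
    (hWy : ∀ t, W t ≠ 0 → |t.2.2.2| ≤ 2 * ε) :
    |∫ U : Fin n → ℝ, ∫ x₁ : ℝ, ∫ x₂ : ℝ, ∫ y : ℝ,
        (f (u + U) (x + y + x₁) (x + y + x₂) - f (u + U) (x + x₁) (x + x₂))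
          * W (U, x₁, x₂, y)|
      ≤ 4 * ε * ∫ l in Set.Icc (0 : ℝ) 1, ∫ U : Fin n → ℝ, ∫ x₁ : ℝ, ∫ x₂ : ℝ, ∫ y : ℝ,
          |deriv (fun b => f (u + U) (x + l * y + x₁) b) (x + l * y + x₂)|
            * W (U, x₁, x₂, y) := by
  set F : (Fin n → ℝ) × ℝ × ℝ → ℝ := fun p => f p.1 p.2.1 p.2.2 with hF
  have hFd : Differentiable ℝ F := hf.differentiable (by simp)
  have hFc : Continuous F := hf.continuous
  obtain ⟨d, hd⟩ : ∃ d : (Fin n → ℝ) → ℝ → ℝ → ℝ,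
      d = fun U a b => deriv (fun b => f U a b) b := ⟨_, rfl⟩
  have hB : ∀ U a b, HasDerivAt (fun b => f U a b) (fderiv ℝ F (U, a, b) (0, 0, 1)) b := by
    intro U a b
    have h := (hFd (U, a, b)).hasFDerivAt.comp_hasDerivAt b
      (f := fun b => (U, a, b))
      ((hasDerivAt_const b U).prodMk ((hasDerivAt_const b a).prodMk (hasDerivAt_id b)))
    exact h
  have hA : ∀ U a b, HasDerivAt (fun a => f U a b) (fderiv ℝ F (U, a, b) (0, 1, 0)) a := by
    intro U a b
    have h := (hFd (U, a, b)).hasFDerivAt.comp_hasDerivAt a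
      (f := fun a => (U, a, b))
      ((hasDerivAt_const a U).prodMk ((hasDerivAt_id a).prodMk (hasDerivAt_const a b)))
    exact h
  have hdB : ∀ U a b, fderiv ℝ F (U, a, b) (0, 0, 1) = d U a b := by
    intro U a b; rw [hd]; exact (hB U a b).deriv.symm
  have hdA : ∀ U a b, fderiv ℝ F (U, a, b) (0, 1, 0) = d U b a := by
    intro U a b
    rw [← (hA U a b).deriv, hd]
    simp only [hsymm U _ b]
  have hdc : Continuous fun p : (Fin n → ℝ) × ℝ × ℝ => d p.1 p.2.1 p.2.2 := by
    have : (fun p : (Fin n → ℝ) × ℝ × ℝ => d p.1 p.2.1 p.2.2)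
        = fun p => fderiv ℝ F p (0, 0, 1) := by
      ext p; exact (hdB _ _ _).symm
    rw [this]
    exact (hf.continuous_fderiv (by simp)).clm_apply continuous_const
  have hdc' : ∀ {Z : Type} [TopologicalSpace Z] (p : Z → Fin n → ℝ) (q r : Z → ℝ),
      Continuous p → Continuous q → Continuous r →
      Continuous fun z => d (p z) (q z) (r z) := by
    intro Z _ p q r hp hq hr
    exact hdc.comp (hp.prodMk (hq.prodMk hr))
  -- derivative along the line
  have hline : ∀ U a b y l, HasDerivAt (fun l => f U (x + l * y + a) (x + l * y + b))
      (y * (d U (x + l * y + b) (x + l * y + a) + d U (x + l * y + a) (x + l * y + b))) l := by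
    intro U a b y l
    have e : ∀ c, HasDerivAt (fun l => x + l * y + c) y l := by
      intro c
      simpa using (((hasDerivAt_id l).mul_const y).const_add x).add_const c
    have h := (hFd (U, x + l * y + a, x + l * y + b)).hasFDerivAt.comp_hasDerivAt l
      (f := fun l => (U, x + l * y + a, x + l * y + b))
      ((hasDerivAt_const l U).prodMk ((e a).prodMk (e b)))
    refine h.congr_deriv ?_
    rw [← hdA, ← hdB, ← map_add, ← smul_eq_mul y, ← map_smul]
    simp
  let H : ℝ × ((Fin n → ℝ) × ℝ × ℝ × ℝ) → ℝ := fun q => |d (u + q.2.1) (x + q.1 * q.2.2.2.2 + q.2.2.1)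
    (x + q.1 * q.2.2.2.2 + q.2.2.2.1)| * W q.2
  let sw : (Fin n → ℝ) × ℝ × ℝ × ℝ → (Fin n → ℝ) × ℝ × ℝ × ℝ := fun t => (t.1, t.2.2.1, t.2.1, t.2.2.2)
  have hsw : MeasurePreserving sw volume volume := sw_mp n
  have hswc : Continuous sw := by fun_prop
  have hHc : Continuous H := by
    refine (Continuous.abs (hdc' _ _ _ ?_ ?_ ?_)).mul (hW.comp continuous_snd) <;> fun_prop
  have hHi : Integrable H ((volume.restrict (Set.Icc (0:ℝ) 1)).prod (volume : Measure ((Fin n → ℝ) × ℝ × ℝ × ℝ))) := by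
    have h1 : IntegrableOn H (Set.Icc (0:ℝ) 1 ×ˢ tsupport W) :=
      hHc.continuousOn.integrableOn_compact (isCompact_Icc.prod hWs)
    have h2 : IntegrableOn H (Set.Icc (0:ℝ) 1 ×ˢ (Set.univ : Set ((Fin n → ℝ) × ℝ × ℝ × ℝ))) := by
      refine h1.of_forall_sdiff_eq_zero (measurableSet_Icc.prod MeasurableSet.univ) ?_
      rintro ⟨l, t⟩ ht
      have : W t = 0 := by
        by_contra hne
        exact ht.2 ⟨ht.1.1, subset_tsupport _ hne⟩
      simp [H, this]
    have h3 := Measure.prod_restrict (μ := (volume : Measure ℝ)) (ν := (volume : Measure ((Fin n → ℝ) × ℝ × ℝ × ℝ)))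
      (Set.Icc (0:ℝ) 1) Set.univ
    rw [Measure.restrict_univ] at h3
    rw [h3]
    exact h2
  have hHl : ∀ l, ∫ U : Fin n → ℝ, ∫ x₁ : ℝ, ∫ x₂ : ℝ, ∫ y : ℝ,
          |deriv (fun b => f (u + U) (x + l * y + x₁) b) (x + l * y + x₂)|
            * W (U, x₁, x₂, y) = ∫ t, H (l, t) := by
    intro l
    rw [← iter_eq (fun t => H (l, t)) (by fun_prop) ?_]
    · simp only [H, hd]
    · exact hWs.mul_left
  simp only [hHl]
  let G : (Fin n → ℝ) × ℝ × ℝ × ℝ → ℝ := fun t => (f (u + t.1) (x + t.2.2.2 + t.2.1) (x + t.2.2.2 + t.2.2.1)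
    - f (u + t.1) (x + t.2.1) (x + t.2.2.1)) * W t
  have hfc' : ∀ {Z : Type} [TopologicalSpace Z] (p : Z → Fin n → ℝ) (q r : Z → ℝ),
      Continuous p → Continuous q → Continuous r →
      Continuous fun z => f (p z) (q z) (r z) := by
    intro Z _ p q r hp hq hr
    exact hFc.comp (hp.prodMk (hq.prodMk hr))
  have hGc : Continuous G := by
    refine Continuous.mul (Continuous.sub (hfc' _ _ _ ?_ ?_ ?_) (hfc' _ _ _ ?_ ?_ ?_)) hW <;>
      fun_prop
  have hGs : HasCompactSupport G := hWs.mul_left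
  have hG := iter_eq G hGc hGs
  simp only [G] at hG
  rw [hG]
  let J : (Fin n → ℝ) × ℝ × ℝ × ℝ → ℝ := fun t => ∫ l in Set.Icc (0:ℝ) 1, H (l, t)
  have hJi : Integrable J := hHi.integral_prod_right
  have hJ : ∫ l in Set.Icc (0:ℝ) 1, ∫ t, H (l, t) = ∫ t, J t :=
    integral_integral_swap (f := fun l t => H (l, t)) hHi
  have hJsi : Integrable (fun t => J (sw t)) := hsw.integrable_comp_of_integrable hJi
  have hJs : ∫ t, J (sw t) = ∫ t, J t := by
    have := integral_map (μ := volume) hsw.measurable.aemeasurable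
      (f := J) (by rw [hsw.map_eq]; exact hJi.aestronglyMeasurable)
    rw [hsw.map_eq] at this
    exact this.symm
  rw [hJ]
  have hpt : ∀ t, |G t| ≤ 2 * ε * (J t + J (sw t)) := by
    rintro ⟨U, a, b, y⟩
    by_cases hw : W (U, a, b, y) = 0
    · have hw' : W (U, b, a, y) = 0 := by rw [← hWsw]; exact hw
      simp [G, J, H, sw, hw, hw']
    have hy : |y| ≤ 2 * ε := hWy _ hw
    have hc1 : Continuous fun l => d (u + U) (x + l * y + b) (x + l * y + a) :=
      hdc' _ _ _ (by fun_prop) (by fun_prop) (by fun_prop)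
    have hc2 : Continuous fun l => d (u + U) (x + l * y + a) (x + l * y + b) :=
      hdc' _ _ _ (by fun_prop) (by fun_prop) (by fun_prop)
    have hftc := intervalIntegral.integral_eq_sub_of_hasDerivAt (a := 0) (b := 1)
      (fun l _ => hline (u + U) a b y l)
      ((continuous_const.mul (hc1.add hc2)).intervalIntegrable 0 1)
    simp only [one_mul, zero_mul, add_zero] at hftc
    have hJ1 : J (U, a, b, y) = (∫ l in (0:ℝ)..1,
        |d (u + U) (x + l * y + a) (x + l * y + b)|) * W (U, a, b, y) := by
      simp only [J, H]
      rw [integral_mul_const, integral_Icc_eq_integral_Ioc,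
        intervalIntegral.integral_of_le zero_le_one]
    have hJ2 : J (sw (U, a, b, y)) = (∫ l in (0:ℝ)..1,
        |d (u + U) (x + l * y + b) (x + l * y + a)|) * W (U, a, b, y) := by
      simp only [J, H, sw]
      rw [integral_mul_const, integral_Icc_eq_integral_Ioc,
        intervalIntegral.integral_of_le zero_le_one, hWsw]
    rw [hJ1, hJ2, ← add_mul, ← mul_assoc]
    simp only [G]
    rw [abs_mul, abs_of_nonneg (hW0 _)]
    refine mul_le_mul_of_nonneg_right ?_ (hW0 _)
    rw [← hftc, ← intervalIntegral.integral_add (hc2.abs.intervalIntegrable 0 1)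
      (hc1.abs.intervalIntegrable 0 1), ← intervalIntegral.integral_const_mul]
    refine (intervalIntegral.abs_integral_le_integral_abs zero_le_one).trans ?_
    refine intervalIntegral.integral_mono_on zero_le_one
      ((continuous_const.mul (hc1.add hc2)).abs.intervalIntegrable 0 1)
      ((continuous_const.mul (hc2.abs.add hc1.abs)).intervalIntegrable 0 1) ?_
    intro l _
    rw [abs_mul]
    refine mul_le_mul hy ?_ (abs_nonneg _) ((abs_nonneg _).trans hy)
    rw [add_comm]
    exact abs_add_le _ _
  calc |∫ t, G t| ≤ ∫ t, |G t| := abs_integral_le_integral_abs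
    _ ≤ ∫ t, 2 * ε * (J t + J (sw t)) :=
      integral_mono (hGc.integrable_of_hasCompactSupport hGs).abs
        ((hJi.add hJsi).const_mul _) hpt
    _ = 4 * ε * ∫ t, J t := by
      rw [integral_const_mul, integral_add hJi hJsi, hJs]; ring

end S16

/-- Key mollification estimate: for a smooth `f : ℝⁿ × ℝ × ℝ → ℝ`, symmetric in its last
two arguments, and independent random variables `U ∈ ℝⁿ` (i.i.d. density `η^ε`),
`X₁, X₂` (density `η^ε`) and `Y` (density `η₂^ε = η^ε * η^ε`),
`|E[f(u+U, x+Y+X₁, x+Y+X₂)] - E[f(u+U, x+X₁, x+X₂)]|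
  ≤ 4ε ∫_0^1 E[|∂_{n+2} f(u+U, x+λY+X₁, x+λY+X₂)|] dλ`,
where expectations are written as integrals against the densities. -/
theorem stmt_16 (n : ℕ) (η : ℝ → ℝ) (hsmooth : ContDiff ℝ (⊤ : ℕ∞) η) (hpos : ∀ z, 0 ≤ η z)
    (heven : ∀ z, η (-z) = η z) (hsupp : Function.support η ⊆ Set.Icc (-1) 1)
    (hint : ∫ z, η z = 1) (ε : ℝ) (hε : 0 < ε) (hε1 : ε < 1)
    (f : (Fin n → ℝ) → ℝ → ℝ → ℝ)
    (hf : ContDiff ℝ (⊤ : ℕ∞) fun p : (Fin n → ℝ) × ℝ × ℝ => f p.1 p.2.1 p.2.2)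
    (hsymm : ∀ u a b, f u a b = f u b a)
    (u : Fin n → ℝ) (x : ℝ) :
    let ηε : ℝ → ℝ := fun z => η (z / ε) / ε
    let η₂ε : ℝ → ℝ := fun z => ∫ w, ηε (z - w) * ηε w
    |∫ U : Fin n → ℝ, ∫ x₁ : ℝ, ∫ x₂ : ℝ, ∫ y : ℝ,
        (f (u + U) (x + y + x₁) (x + y + x₂) - f (u + U) (x + x₁) (x + x₂))
          * ((∏ i, ηε (U i)) * ηε x₁ * ηε x₂ * η₂ε y)|
      ≤ 4 * ε * ∫ l in Set.Icc (0 : ℝ) 1, ∫ U : Fin n → ℝ, ∫ x₁ : ℝ, ∫ x₂ : ℝ, ∫ y : ℝ,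
          |deriv (fun b => f (u + U) (x + l * y + x₁) b) (x + l * y + x₂)|
            * ((∏ i, ηε (U i)) * ηε x₁ * ηε x₂ * η₂ε y) := by
  intro ηε η₂ε
  have hc : Continuous ηε := (hsmooth.continuous.comp (continuous_id.div_const ε)).div_const ε
  have hp : ∀ z, 0 ≤ ηε z := fun z => div_nonneg (hpos _) hε.le
  have hs : ∀ z, ηε z ≠ 0 → z ∈ Set.Icc (-ε) ε := by
    intro z hz
    have h1 : η (z / ε) ≠ 0 := fun h => hz (by simp [ηε, h])
    have h2 := hsupp h1
    rw [Set.mem_Icc, le_div_iff₀ hε, div_le_iff₀ hε] at h2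
    exact ⟨by linarith [h2.1], by linarith [h2.2]⟩
  have hcs : HasCompactSupport ηε :=
    HasCompactSupport.of_support_subset_isCompact isCompact_Icc hs
  have hc2 : Continuous η₂ε := by
    have h := hcs.continuous_convolution_right (ContinuousLinearMap.mul ℝ ℝ)
      (μ := volume) hc.locallyIntegrable hc
    convert h using 1
    ext z
    simp only [η₂ε, convolution_def, ContinuousLinearMap.mul_apply', mul_comm]
  have hp2 : ∀ z, 0 ≤ η₂ε z := fun z => integral_nonneg fun w => mul_nonneg (hp _) (hp _)
  have hs2 : ∀ z, η₂ε z ≠ 0 → z ∈ Set.Icc (-(2 * ε)) (2 * ε) := by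
    intro z hz
    by_contra hne
    apply hz
    have : ∀ w, ηε (z - w) * ηε w = 0 := by
      intro w
      by_contra h
      have h1 := hs _ (left_ne_zero_of_mul h)
      have h2 := hs _ (right_ne_zero_of_mul h)
      exact hne ⟨by linarith [h1.1, h2.1], by linarith [h1.2, h2.2]⟩
    simp [η₂ε, this]
  refine S16.main f hf hsymm u x ε
    (fun t => (∏ i, ηε (t.1 i)) * ηε t.2.1 * ηε t.2.2.1 * η₂ε t.2.2.2) (by fun_prop) ?_ ?_ ?_ ?_
  · refine HasCompactSupport.of_support_subset_isCompact
      (K := (Set.univ.pi fun _ => Set.Icc (-ε) ε) ×ˢ Set.Icc (-ε) ε ×ˢ Set.Icc (-ε) ε ×ˢ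
        Set.Icc (-(2 * ε)) (2 * ε))
      ((isCompact_univ_pi fun _ => isCompact_Icc).prod
        (isCompact_Icc.prod (isCompact_Icc.prod isCompact_Icc))) ?_
    intro t ht
    have h4 := right_ne_zero_of_mul ht
    have h123 := left_ne_zero_of_mul ht
    have h3 := right_ne_zero_of_mul h123
    have h12 := left_ne_zero_of_mul h123
    have h2 := right_ne_zero_of_mul h12
    have h1 := left_ne_zero_of_mul h12
    rw [Finset.prod_ne_zero_iff] at h1
    exact ⟨fun i _ => hs _ (h1 i (Finset.mem_univ i)), hs _ h2, hs _ h3, hs2 _ h4⟩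
  · intro t
    exact mul_nonneg (mul_nonneg (mul_nonneg (Finset.prod_nonneg fun i _ => hp _) (hp _)) (hp _))
      (hp2 _)
  · intro U a b y
    dsimp only
    ring
  · intro t ht
    exact abs_le.2 (hs2 _ (right_ne_zero_of_mul ht))
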